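/- Let X be a separable Banach space, ξ ∈ X* nonzero, and let (A, σ) be a bounded, ξ-Markov operator cocycle on X that is ξ-mixing with rate ρ ∈ [0,1), with lift 𝔸 on 𝒳. For each c ∈ ℂ, the set 𝒳_c = {f ∈ L^∞(Ω, X) : ξ(f(ω)) = c for P-a.e. ω} is nonempty and invariant under 𝔸, there exists n_0 ∈ ℕ such that for all n ≥ n_0 the map 𝔸^n is a contraction of 𝒳_c (with respect to the L^∞(Ω,X) norm), and 𝔸 has a unique fixed point v_c in 𝒳_c, which satisfies v_c = c · v_1. Equivalently, there is a unique (up to P-a.e. equality) v ∈ L^∞(Ω, X) such that ξ(v(ω)) = 1 and A(ω) v(ω) = v(σω) for P-a.e. ω. -/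

import Mathlib

open MeasureTheory

noncomputable section

variable {Ω : Type*} [MeasurableSpace Ω]
variable {X : Type*} [NormedAddCommGroup X] [NormedSpace ℂ X] [CompleteSpace X]

/-- The iterates `A^{(n)}(ω) = A(σ^{n-1} ω) ∘ ⋯ ∘ A(ω)` of an operator cocycle. -/
def cocycleIter (A : Ω → X →L[ℂ] X) (σ : Ω → Ω) : ℕ → Ω → (X →L[ℂ] X)
  | 0, _ => 1
  | n + 1, ω => (cocycleIter A σ n (σ ω)).comp (A ω)

/-- The closed subspace `𝒳 = {f ∈ L^∞(Ω, X) : ξ ∘ f is a.s. constant}` of `L^∞(Ω, X)`. -/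
def scrX (P : Measure Ω) (ξ : X →L[ℂ] ℂ) : Submodule ℂ (Lp X ⊤ P) where
  carrier := {f | ∃ c : ℂ, ∀ᵐ ω ∂P, ξ (f ω) = c}
  add_mem' := by
    rintro f g ⟨c, hc⟩ ⟨d, hd⟩
    refine ⟨c + d, ?_⟩
    filter_upwards [hc, hd, Lp.coeFn_add f g] with ω h1 h2 h3
    rw [h3, Pi.add_apply, map_add, h1, h2]
  zero_mem' := by
    refine ⟨0, ?_⟩
    filter_upwards [Lp.coeFn_zero X ⊤ P] with ω h
    rw [h, Pi.zero_apply, map_zero]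
  smul_mem' := by
    rintro a f ⟨c, hc⟩
    refine ⟨a * c, ?_⟩
    filter_upwards [hc, Lp.coeFn_smul a f] with ω h1 h2
    rw [h2, Pi.smul_apply, _root_.map_smul, h1, smul_eq_mul]

/-- `𝔸` is the lift of the operator cocycle `(A, σ)`, i.e. `(𝔸 f)(ω) = A(σ⁻¹ ω) f(σ⁻¹ ω)`. -/
def IsLift (P : Measure Ω) (ξ : X →L[ℂ] ℂ) (σ : Ω ≃ᵐ Ω) (A : Ω → X →L[ℂ] X)
    (𝔸 : ↥(scrX P ξ) →L[ℂ] ↥(scrX P ξ)) : Prop :=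
  ∀ f : ↥(scrX P ξ),
    (((𝔸 f : Lp X ⊤ P) : Ω → X)) =ᵐ[P]
      fun ω => A (σ.symm ω) (((f : Lp X ⊤ P) : Ω → X) (σ.symm ω))

/-- The subset `𝒳_c = {f ∈ L^∞(Ω, X) : ξ(f(ω)) = c a.s.}` of `𝒳`. -/
def Xconst (P : Measure Ω) (ξ : X →L[ℂ] ℂ) (c : ℂ) : Set ↥(scrX P ξ) :=
  {f | ∀ᵐ ω ∂P, ξ (((f : Lp X ⊤ P) : Ω → X) ω) = c}

theorem MeasureTheory.MeasurePreserving.ae_comp_iff {P : Measure Ω} {σ : Ω ≃ᵐ Ω}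
    (hσ : MeasurePreserving σ P P) {p : Ω → Prop} :
    (∀ᵐ ω ∂P, p (σ ω)) ↔ ∀ᵐ ω ∂P, p ω := by
  refine ⟨fun h => ?_, fun h => hσ.quasiMeasurePreserving.ae h⟩
  simpa using (hσ.symm σ).quasiMeasurePreserving.ae h

theorem MeasureTheory.MeasurePreserving.ae_iterate_comp_iff {P : Measure Ω} {σ : Ω ≃ᵐ Ω}
    (hσ : MeasurePreserving σ P P) (n : ℕ) {p : Ω → Prop} :
    (∀ᵐ ω ∂P, p (σ^[n] ω)) ↔ ∀ᵐ ω ∂P, p ω := by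
  induction n with
  | zero => rfl
  | succ n ih =>
    rw [← ih]
    exact hσ.ae_comp_iff (p := fun ω => p (σ^[n] ω))

theorem MeasureTheory.Lp.ae_norm_le_norm_top {E : Type*} [NormedAddCommGroup E]
    {P : Measure Ω} (f : Lp E ⊤ P) :
    ∀ᵐ ω ∂P, ‖f ω‖ ≤ ‖f‖ := by
  filter_upwards [enorm_ae_le_eLpNormEssSup f P] with ω h
  rw [Lp.norm_def, eLpNorm_exponent_top, ← toReal_enorm (f ω)]
  refine ENNReal.toReal_mono ?_ h
  rw [← eLpNorm_exponent_top]
  exact Lp.eLpNorm_ne_top f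

theorem MeasureTheory.Lp.norm_top_le_of_ae_bound {E : Type*} [NormedAddCommGroup E]
    {P : Measure Ω} [IsFiniteMeasure P] {f : Lp E ⊤ P} {C : ℝ} (hC : 0 ≤ C) (h : ∀ᵐ ω ∂P, ‖f ω‖ ≤ C) : ‖f‖ ≤ C := by
  simpa using Lp.norm_le_of_ae_bound hC h

section Lift

variable {E : Type*} [NormedAddCommGroup E] [NormedSpace ℂ E] {P : Measure Ω} {ξ : E →L[ℂ] ℂ}
  {σ : Ω ≃ᵐ Ω} {A : Ω → E →L[ℂ] E} {𝔸 : ↥(scrX P ξ) →L[ℂ] ↥(scrX P ξ)}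

theorem isClosed_setOf_ae_eq_const [IsFiniteMeasure P] (ξ : E →L[ℂ] ℂ) (c : ℂ) :
    IsClosed {f : Lp E ⊤ P | ∀ᵐ ω ∂P, ξ (f ω) = c} := by
  have h : {f : Lp E ⊤ P | ∀ᵐ ω ∂P, ξ (f ω) = c}
      = (ξ.compLpL ⊤ P) ⁻¹' {Lp.const ⊤ P c} := by
    ext f
    simp only [Set.mem_ofPred_eq, Set.mem_preimage, Set.mem_singleton_iff]
    constructor
    · intro hf
      refine Lp.ext ?_
      filter_upwards [hf, ξ.coeFn_compLpL f, Lp.coeFn_const (p := ⊤) (μ := P) c] with ω h1 h2 h3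
      rw [h2, h3, h1, Function.const_apply]
    · intro hf
      filter_upwards [ξ.coeFn_compLpL f, Lp.coeFn_const (p := ⊤) (μ := P) c] with ω h2 h3
      rw [← h2, hf, h3, Function.const_apply]
  rw [h]
  exact isClosed_singleton.preimage (ξ.compLpL ⊤ P).continuous

theorem sub_mem_Xconst {c d : ℂ} {f g : ↥(scrX P ξ)} (hf : f ∈ Xconst P ξ c)
    (hg : g ∈ Xconst P ξ d) : f - g ∈ Xconst P ξ (c - d) := by
  filter_upwards [hf, hg, Lp.coeFn_sub (f : Lp E ⊤ P) g] with ω h1 h2 h3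
  rw [Submodule.coe_sub, h3, Pi.sub_apply, map_sub, h1, h2]

theorem smul_mem_Xconst (a : ℂ) {c : ℂ} {f : ↥(scrX P ξ)} (hf : f ∈ Xconst P ξ c) :
    a • f ∈ Xconst P ξ (a * c) := by
  filter_upwards [hf, Lp.coeFn_smul a (f : Lp E ⊤ P)] with ω h1 h2
  rw [Submodule.coe_smul, h2, Pi.smul_apply, map_smul, h1, smul_eq_mul]

theorem Xconst_nonempty [IsFiniteMeasure P] (hξ : ξ ≠ 0) (c : ℂ) : (Xconst P ξ c).Nonempty := by
  obtain ⟨x, hx⟩ := LinearMap.surjective (f := ξ.toLinearMap)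
    (fun h => hξ (ContinuousLinearMap.coe_injective h)) c
  have h : ∀ᵐ ω ∂P, ξ (Lp.const ⊤ P x ω) = c := by
    filter_upwards [Lp.coeFn_const (p := ⊤) (μ := P) x] with ω h
    rw [h]
    exact hx
  exact ⟨⟨Lp.const ⊤ P x, c, h⟩, h⟩

theorem isComplete_Xconst [CompleteSpace E] [IsFiniteMeasure P] (c : ℂ) : IsComplete (Xconst P ξ c) := by
  refine (isComplete_image_iff isUniformEmbedding_subtype_val.isUniformInducing).1 ?_
  have h : (Subtype.val '' Xconst P ξ c) = {f : Lp E ⊤ P | ∀ᵐ ω ∂P, ξ (f ω) = c} := by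
    ext f
    exact ⟨by rintro ⟨g, hg, rfl⟩; exact hg, fun hf => ⟨⟨f, c, hf⟩, hf, rfl⟩⟩
  rw [h]
  exact (isClosed_setOf_ae_eq_const ξ c).isComplete

theorem IsLift.ae_apply (h𝔸 : IsLift P ξ σ A 𝔸) (hσ : MeasurePreserving σ P P)
    (f : ↥(scrX P ξ)) :
    ∀ᵐ ω ∂P, (𝔸 f : Lp E ⊤ P) (σ ω) = A ω ((f : Lp E ⊤ P) ω) := by
  filter_upwards [hσ.quasiMeasurePreserving.ae (h𝔸 f)] with ω h
  simpa using h

theorem IsLift.ae_pow_apply (h𝔸 : IsLift P ξ σ A 𝔸) (hσ : MeasurePreserving σ P P) (n : ℕ)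
    (f : ↥(scrX P ξ)) :
    ∀ᵐ ω ∂P, ((𝔸 ^ n) f : Lp E ⊤ P) (σ^[n] ω) = cocycleIter A σ n ω ((f : Lp E ⊤ P) ω) := by
  induction n generalizing f with
  | zero => exact Filter.Eventually.of_forall fun ω => rfl
  | succ n ih =>
    filter_upwards [h𝔸.ae_apply hσ f, hσ.quasiMeasurePreserving.ae (ih (𝔸 f))] with ω h1 h2
    rw [pow_succ, mul_apply_eq_comp, Function.iterate_succ_apply, h2, h1]
    rfl

theorem IsLift.eq_self_iff (h𝔸 : IsLift P ξ σ A 𝔸) (hσ : MeasurePreserving σ P P)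
    (f : ↥(scrX P ξ)) :
    𝔸 f = f ↔ ∀ᵐ ω ∂P, A ω ((f : Lp E ⊤ P) ω) = (f : Lp E ⊤ P) (σ ω) := by
  constructor
  · intro hf
    filter_upwards [h𝔸.ae_apply hσ f] with ω h
    rw [← h, hf]
  · intro hf
    refine Subtype.ext (Lp.ext (hσ.ae_comp_iff.1 ?_))
    filter_upwards [h𝔸.ae_apply hσ f, hf] with ω h1 h2
    rw [h1, h2]

theorem IsLift.apply_mem_Xconst (h𝔸 : IsLift P ξ σ A 𝔸) (hσ : MeasurePreserving σ P P)
    (hMarkov : ∀ᵐ ω ∂P, ∀ f : E, ξ (A ω f) = ξ f) {c : ℂ} {f : ↥(scrX P ξ)}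
    (hf : f ∈ Xconst P ξ c) : 𝔸 f ∈ Xconst P ξ c := by
  refine hσ.ae_comp_iff.1 ?_
  filter_upwards [h𝔸.ae_apply hσ f, hMarkov, hf] with ω h1 h2 h3
  rw [h1, h2, h3]

theorem IsLift.norm_pow_apply_le [IsFiniteMeasure P] (h𝔸 : IsLift P ξ σ A 𝔸)
    (hσ : MeasurePreserving σ P P) {K : ℝ} (hK : 0 ≤ K) {n : ℕ}
    (hmix : ∀ᵐ ω ∂P, ∀ f : E, ξ f = 0 → ‖cocycleIter A σ n ω f‖ ≤ K * ‖f‖)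
    {f : ↥(scrX P ξ)} (hf : f ∈ Xconst P ξ 0) : ‖(𝔸 ^ n) f‖ ≤ K * ‖f‖ := by
  refine Lp.norm_top_le_of_ae_bound (by positivity) ((hσ.ae_iterate_comp_iff n).1 ?_)
  filter_upwards [h𝔸.ae_pow_apply hσ n f, hmix, hf, Lp.ae_norm_le_norm_top (f : Lp E ⊤ P)]
    with ω h1 h2 h3 h4
  refine (congrArg norm h1).trans_le ?_
  exact (h2 _ h3).trans (mul_le_mul_of_nonneg_left h4 hK)

end Lift

/-- For a bounded, `ξ`-Markov, `ξ`-mixing operator cocycle `(A, σ)` with lift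
`𝔸` on `𝒳`: each `𝒳_c` is nonempty, `𝔸`-invariant, eventually uniformly contracted by `𝔸^n`,
and `𝔸` has a unique fixed point `v_c = c • v_1` in `𝒳_c`.  Equivalently, there is a unique
(up to a.e. equality) essentially bounded strongly measurable `v : Ω → X` with `ξ(v(ω)) = 1` and
`A(ω) v(ω) = v(σ ω)` almost surely. -/
theorem contraction_fixed_point
    (P : Measure Ω) [IsProbabilityMeasure P] (hPc : P.IsComplete)
    [TopologicalSpace.SeparableSpace X]
    (σ : Ω ≃ᵐ Ω) (hσ : Ergodic σ P)
    (ξ : X →L[ℂ] ℂ) (hξ : ξ ≠ 0)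
    (A : Ω → X →L[ℂ] X)
    (hmeas : ∀ f : X, StronglyMeasurable fun ω => A ω f)
    (hMarkov : ∀ᵐ ω ∂P, ∀ f : X, ξ (A ω f) = ξ f)
    (hbdd : ∃ C : ℝ, ∀ᵐ ω ∂P, ‖A ω‖ ≤ C)
    (ρ : ℝ) (hρ0 : 0 ≤ ρ) (hρ1 : ρ < 1)
    (hmix : ∃ C : ℝ, 0 < C ∧ ∀ n : ℕ, 1 ≤ n → ∀ᵐ ω ∂P, ∀ f : X, ξ f = 0 →
      ‖cocycleIter A σ n ω f‖ ≤ C * ρ ^ n * ‖f‖)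
    (𝔸 : ↥(scrX P ξ) →L[ℂ] ↥(scrX P ξ)) (h𝔸 : IsLift P ξ σ A 𝔸) :
    (∃ v1 : ↥(scrX P ξ),
      v1 ∈ Xconst P ξ 1 ∧ 𝔸 v1 = v1 ∧
      ∀ c : ℂ,
        (Xconst P ξ c).Nonempty ∧
        (∀ f ∈ Xconst P ξ c, 𝔸 f ∈ Xconst P ξ c) ∧
        (∃ n0 : ℕ, ∀ n : ℕ, n0 ≤ n → ∃ r : ℝ, 0 ≤ r ∧ r < 1 ∧
          ∀ f ∈ Xconst P ξ c, ∀ g ∈ Xconst P ξ c,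
            ‖(𝔸 ^ n) f - (𝔸 ^ n) g‖ ≤ r * ‖f - g‖) ∧
        c • v1 ∈ Xconst P ξ c ∧ 𝔸 (c • v1) = c • v1 ∧
        (∀ w ∈ Xconst P ξ c, 𝔸 w = w → w = c • v1)) ∧
    (∃ v : Ω → X, StronglyMeasurable v ∧ (∃ K : ℝ, ∀ᵐ ω ∂P, ‖v ω‖ ≤ K) ∧
      (∀ᵐ ω ∂P, ξ (v ω) = 1) ∧ (∀ᵐ ω ∂P, A ω (v ω) = v (σ ω)) ∧
      ∀ w : Ω → X, StronglyMeasurable w → (∃ K : ℝ, ∀ᵐ ω ∂P, ‖w ω‖ ≤ K) →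
        (∀ᵐ ω ∂P, ξ (w ω) = 1) → (∀ᵐ ω ∂P, A ω (w ω) = w (σ ω)) →
        w =ᵐ[P] v) := by
  have hσP := hσ.toMeasurePreserving
  obtain ⟨C, hC, hmix⟩ := hmix
  have hdecay : ∀ n : ℕ, 1 ≤ n → ∀ f ∈ Xconst P ξ 0, ‖(𝔸 ^ n) f‖ ≤ C * ρ ^ n * ‖f‖ :=
    fun n hn f hf => h𝔸.norm_pow_apply_le hσP (by positivity) (hmix n hn) hf
  have hsub : ∀ {c : ℂ} {f g : ↥(scrX P ξ)}, f ∈ Xconst P ξ c → g ∈ Xconst P ξ c →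
      f - g ∈ Xconst P ξ 0 := fun hf hg => by
    simpa using sub_mem_Xconst hf hg
  have hpow : ∀ n : ℕ, ∀ f ∈ Xconst P ξ 1, (𝔸 ^ n) f ∈ Xconst P ξ 1 := fun n => by
    induction n with
    | zero => exact fun f hf => hf
    | succ n ih => exact fun f hf => ih _ (h𝔸.apply_mem_Xconst hσP hMarkov hf)
  have hcontr : ∃ n0 : ℕ, 1 ≤ n0 ∧ ∀ n, n0 ≤ n → C * ρ ^ n < 1 := by
    have h : Filter.Tendsto (fun n : ℕ => C * ρ ^ n) Filter.atTop (nhds 0) := by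
      simpa using (tendsto_pow_atTop_nhds_zero_of_lt_one hρ0 hρ1).const_mul C
    obtain ⟨N, hN⟩ := Filter.eventually_atTop.1 (h.eventually_lt_const one_pos)
    exact ⟨N + 1, by omega, fun n hn => hN n (by omega)⟩
  obtain ⟨n0, hn0, hlt⟩ := hcontr
  have hunique : ∀ {c : ℂ} {f g : ↥(scrX P ξ)}, f ∈ Xconst P ξ c → g ∈ Xconst P ξ c →
      𝔸 f = f → 𝔸 g = g → f = g := by
    intro c f g hf hg hAf hAg
    have hfix : (𝔸 ^ n0) (f - g) = f - g := by
      rw [FunLike.coe_pow_eq_iterate]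
      exact Function.iterate_fixed (by rw [map_sub, hAf, hAg]) n0
    have h := hdecay n0 hn0 _ (hsub hf hg)
    rw [hfix] at h
    rw [← sub_eq_zero, ← norm_eq_zero]
    nlinarith [hlt n0 le_rfl, norm_nonneg (f - g)]
  have hexists : ∃ v ∈ Xconst P ξ 1, 𝔸 v = v := by
    obtain ⟨f, hf⟩ := Xconst_nonempty (P := P) hξ 1
    have hAf := h𝔸.apply_mem_Xconst hσP hMarkov hf
    let u : ℕ → ↥(scrX P ξ) := fun n => (𝔸 ^ (n + 1)) f
    have hu : CauchySeq u := by
      refine cauchySeq_of_le_geometric ρ (C * ρ * ‖𝔸 f - f‖) hρ1 fun n => ?_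
      have h := hdecay (n + 1) (by omega) _ (hsub hAf hf)
      rw [map_sub] at h
      rw [dist_comm, dist_eq_norm]
      refine h.trans_eq ?_
      ring
    obtain ⟨v, hv, hlim⟩ := cauchySeq_tendsto_of_isComplete (isComplete_Xconst (P := P) 1)
      (fun n => hpow (n + 1) f hf) hu
    refine ⟨v, hv, tendsto_nhds_unique ((𝔸.continuous.tendsto v).comp hlim) ?_⟩
    refine ((Filter.tendsto_add_atTop_iff_nat 1).2 hlim).congr fun n => ?_
    simp only [Function.comp_apply, pow_succ' 𝔸 (n + 1), mul_apply_eq_comp]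
  obtain ⟨v1, hv1, hfix⟩ := hexists
  refine ⟨⟨v1, hv1, hfix, fun c => ?_⟩, ?_⟩
  · have hcv : c • v1 ∈ Xconst P ξ c := by simpa using smul_mem_Xconst c hv1
    have hcfix : 𝔸 (c • v1) = c • v1 := by rw [map_smul, hfix]
    refine ⟨⟨_, hcv⟩, fun f hf => h𝔸.apply_mem_Xconst hσP hMarkov hf, ⟨n0, fun n hn =>
      ⟨C * ρ ^ n, by positivity, hlt n hn, fun f hf g hg => ?_⟩⟩, hcv, hcfix,
      fun w hw hAw => hunique hw hcv hAw hcfix⟩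
    rw [← map_sub]
    exact hdecay n (hn0.trans hn) _ (hsub hf hg)
  · refine ⟨(v1 : Lp X ⊤ P), Lp.stronglyMeasurable _, ⟨‖(v1 : Lp X ⊤ P)‖,
      Lp.ae_norm_le_norm_top _⟩, hv1, (h𝔸.eq_self_iff hσP v1).1 hfix, ?_⟩
    rintro w hwm ⟨K, hK⟩ hw1 hwA
    have hwL : MemLp w ⊤ P := memLp_top_of_bound hwm.aestronglyMeasurable K hK
    have hcoe := hwL.coeFn_toLp
    have hmem : ∀ᵐ ω ∂P, ξ (hwL.toLp w ω) = 1 := by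
      filter_upwards [hcoe, hw1] with ω h1 h2
      rw [h1, h2]
    have hfixw : 𝔸 ⟨hwL.toLp w, 1, hmem⟩ = ⟨hwL.toLp w, 1, hmem⟩ := by
      refine (h𝔸.eq_self_iff hσP _).2 ?_
      filter_upwards [hcoe, hσP.quasiMeasurePreserving.ae hcoe, hwA] with ω h1 h2 h3
      rw [h1, h2, h3]
    have heq := hunique (c := 1) hmem hv1 hfixw hfix
    rw [← heq]
    exact hcoe.symm

end
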